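/- arXiv:1712.01929 — 4 statements merged into one kernel-verified Lean document; each statement's English description precedes it below -/
import Mathlib

section
/- For every n ≥ 1 and every (S_1, …, S_n) ∈ 𝓢_n, the unique preimage (I_0, …, I_n) ∈ 𝓘_n of (S_1,…,S_n) under the bijection (I_i)_{i∈[0,n]} ↦ (I_i \ I_{i−1})_{i∈[n]} is given explicitly by I_i = (S_1 ∪ S_2 ∪ … ∪ S_i) \ {j ∈ [i] : min S_j^{-1} < i < max S_j^{-1}} for all i ∈ [0,n]. -/
/-- `Ical n` : Feigin's model. An element is a tuple `(I_0, …, I_n)` of subsets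
of `[n]` (indexed by `Fin (n+1)`) with `#I_i = i` and `I_{i-1} \ {i} ⊆ I_i`. -/
def Ical (n : ℕ) : Set (Fin (n + 1) → Finset ℕ) :=
  {I | (∀ i : Fin (n + 1), I i ⊆ Finset.Icc 1 n ∧ (I i).card = (i : ℕ)) ∧
       (∀ j : Fin n, I j.castSucc \ {(j : ℕ) + 1} ⊆ I j.succ)}

/-- `I_i` for a natural number index `i ∈ [0, n]` (junk value `∅` outside). -/
def IvalAt (n : ℕ) (I : Fin (n + 1) → Finset ℕ) (i : ℕ) : Finset ℕ :=
  if h : i ≤ n then I ⟨i, by omega⟩ else ∅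

/-- `IcalFirst n k` : the `(I_0,…,I_n) ∈ Ical n` with `min {i : 1 ∈ I_i} = k`. -/
def IcalFirst (n k : ℕ) : Set (Fin (n + 1) → Finset ℕ) :=
  {I ∈ Ical n | sInf {i : ℕ | 1 ∈ IvalAt n I i} = k}

/-- `IcalLast n l` : the `(I_0,…,I_n) ∈ Ical n` with `min {i : n ∈ I_i} = l`. -/
def IcalLast (n l : ℕ) : Set (Fin (n + 1) → Finset ℕ) :=
  {I ∈ Ical n | sInf {i : ℕ | n ∈ IvalAt n I i} = l}

/-- `S_j` for a (1-based) index `j ∈ [n]` (junk value `∅` outside). -/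
def SvalAt (n : ℕ) (S : Fin n → Finset ℕ) (j : ℕ) : Finset ℕ :=
  if h : 1 ≤ j ∧ j ≤ n then S ⟨j - 1, by omega⟩ else ∅

/-- `S_i^{-1} = {j ∈ [n] : i ∈ S_j}`. -/
def Sinv (n : ℕ) (S : Fin n → Finset ℕ) (i : ℕ) : Finset ℕ :=
  (Finset.Icc 1 n).filter (fun j => i ∈ SvalAt n S j)

/-- `Scal n` : the set of tuples `(S_1, …, S_n)` of subsets of `[n]` (indexed by
`Fin n`, the entry of index `j` being `S_{j+1}`) such that `#S_i ∈ {1,2}` and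
`#S_i^{-1} ∈ {1,2}` for all `i ∈ [n]`, and whenever `#S_i = 2` there are
`i₁ < i < i₂` with `S_i^{-1} = {i₁, i₂}`. -/
def Scal (n : ℕ) : Set (Fin n → Finset ℕ) :=
  {S | (∀ j : Fin n, S j ⊆ Finset.Icc 1 n) ∧
       (∀ i, 1 ≤ i → i ≤ n →
         ((SvalAt n S i).card = 1 ∨ (SvalAt n S i).card = 2) ∧
         ((Sinv n S i).card = 1 ∨ (Sinv n S i).card = 2) ∧
         ((SvalAt n S i).card = 2 →
           ∃ i₁ i₂, i₁ < i ∧ i < i₂ ∧ Sinv n S i = {i₁, i₂}))}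

/-- `ScalFirst n k` : the `(S_1,…,S_n) ∈ Scal n` with `S_1^{-1} = {k}`. -/
def ScalFirst (n k : ℕ) : Set (Fin n → Finset ℕ) :=
  {S ∈ Scal n | Sinv n S 1 = {k}}

/-- `ScalLast n l` : the `(S_1,…,S_n) ∈ Scal n` with `S_n^{-1} = {l}`. -/
def ScalLast (n l : ℕ) : Set (Fin n → Finset ℕ) :=
  {S ∈ Scal n | Sinv n S n = {l}}

/-- The map `(I_0, …, I_n) ↦ (I_1 \ I_0, …, I_n \ I_{n-1})`. -/
def ItoS (n : ℕ) (I : Fin (n + 1) → Finset ℕ) : Fin n → Finset ℕ :=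
  fun j => I j.succ \ I j.castSucc

def FF (n : ℕ) (S : Fin n → Finset ℕ) (i : ℕ) : Finset ℕ :=
  ((Finset.Icc 1 i).biUnion (fun j => SvalAt n S j)) \
          ((Finset.Icc 1 i).filter (fun j =>
            (Sinv n S j).min < (i : WithTop ℕ) ∧
              ((i : WithBot ℕ) < (Sinv n S j).max)))

theorem mem_Sinv' {n : ℕ} {S : Fin n → Finset ℕ} {k i : ℕ} :
    i ∈ Sinv n S k ↔ k ∈ SvalAt n S i := by
  unfold Sinv SvalAt
  simp only [Finset.mem_filter, Finset.mem_Icc]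
  constructor
  · exact fun h => h.2
  · intro h
    refine ⟨?_, h⟩
    by_contra hc
    simp [hc] at h

theorem Sinv_range {n : ℕ} {S : Fin n → Finset ℕ} {k i : ℕ} (h : i ∈ Sinv n S k) :
    1 ≤ i ∧ i ≤ n := by
  unfold Sinv at h
  simpa using (Finset.mem_filter.1 h).1

theorem Sval_range {n : ℕ} {S : Fin n → Finset ℕ} (hS : S ∈ Scal n) {k i : ℕ}
    (h : k ∈ SvalAt n S i) : 1 ≤ k ∧ k ≤ n := by
  unfold SvalAt at h
  split_ifs at h with hc
  · simpa using hS.1 _ h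
  · simp at h

theorem card2 {n : ℕ} {S : Fin n → Finset ℕ} (hS : S ∈ Scal n) :
    ∀ k ∈ Finset.Icc 1 n, (SvalAt n S k).card = (Sinv n S k).card := by
  have hle : ∀ k ∈ Finset.Icc 1 n, (SvalAt n S k).card ≤ (Sinv n S k).card := by
    intro k hk
    rw [Finset.mem_Icc] at hk
    obtain ⟨h1, h2, h3⟩ := hS.2 k hk.1 hk.2
    rcases h1 with h1 | h1
    · omega
    · obtain ⟨a, b, hab, hb, e⟩ := h3 h1
      rw [h1, e, Finset.card_pair (by omega)]
  have hsum : ∑ k ∈ Finset.Icc 1 n, (SvalAt n S k).card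
      = ∑ k ∈ Finset.Icc 1 n, (Sinv n S k).card := by
    have h := Finset.sum_card_bipartiteAbove_eq_sum_card_bipartiteBelow
      (s := Finset.Icc 1 n) (t := Finset.Icc 1 n) (fun i k => k ∈ SvalAt n S i)
    have e1 : ∀ i, (Finset.Icc 1 n).bipartiteAbove (fun i k => k ∈ SvalAt n S i) i
        = SvalAt n S i := by
      intro i
      ext k
      simp only [Finset.bipartiteAbove, Finset.mem_filter, Finset.mem_Icc]
      exact ⟨fun h => h.2, fun h => ⟨Sval_range hS h, h⟩⟩
    have e2 : ∀ k, (Finset.Icc 1 n).bipartiteBelow (fun i k => k ∈ SvalAt n S i) k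
        = Sinv n S k := fun k => rfl
    simp only [e1, e2] at h
    exact h
  exact (Finset.sum_eq_sum_iff_of_le hle).1 hsum

theorem struct {n : ℕ} {S : Fin n → Finset ℕ} (hS : S ∈ Scal n) (k : ℕ)
    (h1 : 1 ≤ k) (hn : k ≤ n) :
    ((SvalAt n S k).card = 1 ∧ ∃ a, 1 ≤ a ∧ a ≤ n ∧ ∀ i, k ∈ SvalAt n S i ↔ i = a) ∨
    ((SvalAt n S k).card = 2 ∧ ∃ a b, 1 ≤ a ∧ b ≤ n ∧ a < k ∧ k < b ∧
      ∀ i, k ∈ SvalAt n S i ↔ (i = a ∨ i = b)) := by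
  have hc := card2 hS k (Finset.mem_Icc.2 ⟨h1, hn⟩)
  obtain ⟨h1, h2, h3⟩ := hS.2 k h1 hn
  rcases h1 with h1 | h1
  · left
    refine ⟨h1, ?_⟩
    rw [h1] at hc
    obtain ⟨a, ha⟩ := Finset.card_eq_one.1 hc.symm
    have := Sinv_range (n := n) (S := S) (k := k) (i := a) (by simp [ha])
    refine ⟨a, this.1, this.2, fun i => ?_⟩
    rw [← mem_Sinv', ha, Finset.mem_singleton]
  · right
    refine ⟨h1, ?_⟩
    obtain ⟨a, b, hab, hb, e⟩ := h3 h1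
    have ha' := Sinv_range (n := n) (S := S) (k := k) (i := a) (by simp [e])
    have hb' := Sinv_range (n := n) (S := S) (k := k) (i := b) (by simp [e])
    refine ⟨a, b, ha'.1, hb'.2, hab, hb, fun i => ?_⟩
    rw [← mem_Sinv', e, Finset.mem_insert, Finset.mem_singleton]

theorem mem_FF {n : ℕ} {S : Fin n → Finset ℕ} (hS : S ∈ Scal n) (k i : ℕ) :
    k ∈ FF n S i ↔ (∃ a, a ≤ i ∧ k ∈ SvalAt n S a) ∧
      ¬ (k ≤ i ∧ (∃ a, a < i ∧ k ∈ SvalAt n S a) ∧ ∃ b, i < b ∧ k ∈ SvalAt n S b) := by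
  have hmin : (Sinv n S k).min < (i : WithTop ℕ) ↔ ∃ a, a < i ∧ k ∈ SvalAt n S a := by
    rw [Finset.min_eq_inf_withTop, Finset.inf_lt_iff]
    simp only [mem_Sinv']
    constructor
    · rintro ⟨a, h, h'⟩; exact ⟨a, WithTop.coe_lt_coe.1 h', h⟩
    · rintro ⟨a, h, h'⟩; exact ⟨a, h', WithTop.coe_lt_coe.2 h⟩
  have hmax : (i : WithBot ℕ) < (Sinv n S k).max ↔ ∃ a, i < a ∧ k ∈ SvalAt n S a := by
    rw [Finset.max_eq_sup_withBot, Finset.lt_sup_iff]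
    simp only [mem_Sinv']
    constructor
    · rintro ⟨a, h, h'⟩; exact ⟨a, WithBot.coe_lt_coe.1 h', h⟩
    · rintro ⟨a, h, h'⟩; exact ⟨a, h', WithBot.coe_lt_coe.2 h⟩
  unfold FF
  simp only [Finset.mem_sdiff, Finset.mem_biUnion, Finset.mem_filter, Finset.mem_Icc, hmin, hmax]
  constructor
  · rintro ⟨⟨a, ha, hk⟩, h⟩
    exact ⟨⟨a, ha.2, hk⟩, fun h' => h ⟨⟨(Sval_range hS hk).1, h'.1⟩, h'.2⟩⟩
  · rintro ⟨⟨a, ha, hk⟩, h⟩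
    exact ⟨⟨a, ⟨(Sinv_range (mem_Sinv'.2 hk)).1, ha⟩, hk⟩, fun h' => h ⟨h'.1.2, h'.2⟩⟩

theorem FF_range {n : ℕ} {S : Fin n → Finset ℕ} (hS : S ∈ Scal n) {k i : ℕ}
    (h : k ∈ FF n S i) : 1 ≤ k ∧ k ≤ n := by
  obtain ⟨⟨a, _, h⟩, _⟩ := (mem_FF hS k i).1 h
  exact Sval_range hS h

theorem mem_FF' {n : ℕ} {S : Fin n → Finset ℕ} (hS : S ∈ Scal n) (k : ℕ)
    (h1 : 1 ≤ k) (hn : k ≤ n) :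
    ((SvalAt n S k).card = 1 ∧ ∃ a, 1 ≤ a ∧ a ≤ n ∧ (∀ i, k ∈ SvalAt n S i ↔ i = a) ∧
      ∀ i, k ∈ FF n S i ↔ a ≤ i) ∨
    ((SvalAt n S k).card = 2 ∧ ∃ a b, 1 ≤ a ∧ b ≤ n ∧ a < k ∧ k < b ∧
      (∀ i, k ∈ SvalAt n S i ↔ (i = a ∨ i = b)) ∧
      ∀ i, k ∈ FF n S i ↔ (a ≤ i ∧ i < k) ∨ b ≤ i) := by
  rcases struct hS k h1 hn with ⟨hc, a, h1, h2, h⟩ | ⟨hc, a, b, h1, h2, h3, h4, h⟩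
  · left
    refine ⟨hc, a, h1, h2, h, fun i => ?_⟩
    rw [mem_FF hS]
    simp only [h, exists_eq_right]
    omega
  · right
    refine ⟨hc, a, b, h1, h2, h3, h4, h, fun i => ?_⟩
    rw [mem_FF hS]
    simp only [h, and_or_left, exists_or, exists_eq_right]
    omega

theorem mem_step {n : ℕ} {S : Fin n → Finset ℕ} (hS : S ∈ Scal n) (i k : ℕ) :
    k ∈ FF n S (i + 1) ↔
      (k ∈ FF n S i ∧ ¬ (k = i + 1 ∧ (SvalAt n S (i + 1)).card = 2)) ∨
        k ∈ SvalAt n S (i + 1) := by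
  by_cases hk : 1 ≤ k ∧ k ≤ n
  · by_cases e : k = i + 1
    · subst e
      rcases mem_FF' hS _ hk.1 hk.2 with ⟨hc, a, h1, h2, h3, h4⟩ | ⟨hc, a, b, h1, h2, h3, h4, h5, h6⟩
      · rw [h4, h4, h3, hc]; omega
      · rw [h6, h6, h5, hc]; omega
    · rcases mem_FF' hS _ hk.1 hk.2 with ⟨hc, a, h1, h2, h3, h4⟩ | ⟨hc, a, b, h1, h2, h3, h4, h5, h6⟩
      · rw [h4, h4, h3]; simp only [e, false_and, not_false_eq_true, and_true]; omega
      · rw [h6, h6, h5]; simp only [e, false_and, not_false_eq_true, and_true]; omega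
  · have a1 : k ∉ FF n S (i + 1) := fun h => hk (FF_range hS h)
    have a2 : k ∉ FF n S i := fun h => hk (FF_range hS h)
    have a3 : k ∉ SvalAt n S (i + 1) := fun h => hk (Sval_range hS h)
    simp [a1, a2, a3]

theorem disj_step {n : ℕ} {S : Fin n → Finset ℕ} (hS : S ∈ Scal n) (i k : ℕ)
    (h : k ∈ SvalAt n S (i + 1)) : k ∉ FF n S i := by
  intro h'
  have hk := Sval_range hS h
  have hi := Sinv_range (mem_Sinv'.2 h)
  rcases mem_FF' hS _ hk.1 hk.2 with ⟨hc, a, h1, h2, h3, h4⟩ | ⟨hc, a, b, h1, h2, h3, h4, h5, h6⟩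
  · rw [h4] at h'; rw [h3] at h; omega
  · rw [h6] at h'; rw [h5] at h; omega

theorem mem_two {n : ℕ} {S : Fin n → Finset ℕ} (hS : S ∈ Scal n) (i : ℕ) (hi : i + 1 ≤ n)
    (h : (SvalAt n S (i + 1)).card = 2) :
    i + 1 ∈ FF n S i := by
  rcases mem_FF' hS (i + 1) (by omega) hi with ⟨hc, a, h1, h2, h3, h4⟩ | ⟨hc, a, b, h1, h2, h3, h4, h5, h6⟩
  · omega
  · rw [h6]; omega

theorem FF_zero (n : ℕ) (S : Fin n → Finset ℕ) : FF n S 0 = ∅ := by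
  simp [FF]

theorem FF_step {n : ℕ} {S : Fin n → Finset ℕ} (hS : S ∈ Scal n) (i : ℕ) :
    FF n S (i + 1) = (if (SvalAt n S (i + 1)).card = 2 then (FF n S i).erase (i + 1)
      else FF n S i) ∪ SvalAt n S (i + 1) := by
  ext k
  rw [mem_step hS]
  split_ifs with h
  · simp only [h, Finset.mem_union, Finset.mem_erase]; tauto
  · simp [h]

theorem FF_card {n : ℕ} {S : Fin n → Finset ℕ} (hS : S ∈ Scal n) (i : ℕ) (hi : i ≤ n) :
    (FF n S i).card = i := by
  induction i with
  | zero => simp [FF_zero]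
  | succ i ih =>
    have ih := ih (by omega)
    have hd : Disjoint (FF n S i) (SvalAt n S (i + 1)) :=
      Finset.disjoint_right.2 fun k hk => disj_step hS i k hk
    rw [FF_step hS]
    split_ifs with h
    · rw [Finset.card_union_of_disjoint (hd.mono_left (Finset.erase_subset _ _)),
        Finset.card_erase_of_mem (mem_two hS i hi h), h, ih]
      have := Finset.card_pos.2 ⟨_, mem_two hS i hi h⟩
      omega
    · rw [Finset.card_union_of_disjoint hd, ih]
      rcases (hS.2 (i + 1) (by omega) hi).1 with h' | h'
      · omega
      · omega

theorem SvalAt_succ {n : ℕ} (S : Fin n → Finset ℕ) (j : Fin n) :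
    SvalAt n S ((j : ℕ) + 1) = S j := by
  unfold SvalAt
  rw [dif_pos ⟨by omega, by omega⟩]
  rfl

theorem FF_mem {n : ℕ} {S : Fin n → Finset ℕ} (hS : S ∈ Scal n) :
    (fun i : Fin (n + 1) => FF n S i) ∈ Ical n ∧ ItoS n (fun i : Fin (n + 1) => FF n S i) = S := by
  refine ⟨⟨fun i => ⟨fun k hk => Finset.mem_Icc.2 (FF_range hS hk), FF_card hS _ (by omega)⟩, ?_⟩, ?_⟩
  · intro j k hk
    simp only [Fin.val_succ, Fin.val_castSucc, Finset.mem_sdiff, Finset.mem_singleton] at hk ⊢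
    rw [mem_step hS]
    tauto
  · funext j
    ext k
    simp only [ItoS, Fin.val_succ, Fin.val_castSucc, Finset.mem_sdiff]
    rw [mem_step hS, ← SvalAt_succ S j]
    have := disj_step hS j k
    tauto

theorem uniq {n : ℕ} {S : Fin n → Finset ℕ} (hS : S ∈ Scal n) (I : Fin (n + 1) → Finset ℕ)
    (hI : I ∈ Ical n) (e : ItoS n I = S) (i : Fin (n + 1)) : I i = FF n S i := by
  induction i using Fin.induction with
  | zero =>
    have := (hI.1 0).2
    simp only [Fin.val_zero] at this ⊢
    rw [FF_zero]
    exact Finset.card_eq_zero.1 this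
  | succ j ih =>
    have hSj : I j.succ \ I j.castSucc = SvalAt n S ((j : ℕ) + 1) := by
      rw [SvalAt_succ, ← e]; rfl
    have c1 := (hI.1 j.succ).2
    have c0 := (hI.1 j.castSucc).2
    have hsub := hI.2 j
    simp only [Fin.val_succ, Fin.val_castSucc] at c1 c0 ih ⊢
    have k1 := Finset.card_sdiff_add_card_inter (I j.succ) (I j.castSucc)
    have k0 := Finset.card_sdiff_add_card_inter (I j.castSucc) (I j.succ)
    rw [Finset.inter_comm] at k0
    rw [hSj, c1] at k1
    rw [c0] at k0
    have hm : ∀ k, k ∈ SvalAt n S ((j : ℕ) + 1) ↔ k ∈ I j.succ ∧ k ∉ I j.castSucc := by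
      intro k; rw [← hSj, Finset.mem_sdiff]
    ext k
    rw [mem_step hS, ← ih, hm]
    have hk := @hsub k
    simp only [Finset.mem_sdiff, Finset.mem_singleton] at hk
    by_cases h2 : (SvalAt n S ((j : ℕ) + 1)).card = 2
    · have : (I j.castSucc \ I j.succ).card = 1 := by omega
      obtain ⟨x, hx⟩ := Finset.card_eq_one.1 this
      have hx' : x ∈ I j.castSucc \ I j.succ := by simp [hx]
      have hxj := @hsub x
      simp only [Finset.mem_sdiff, Finset.mem_singleton] at hxj hx'
      have : x = (j : ℕ) + 1 := by tauto
      subst this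
      by_cases hkj : k = (j : ℕ) + 1
      · subst hkj; tauto
      · tauto
    · have h1 := (hS.2 ((j : ℕ) + 1) (by omega) (by omega)).1
      have : (I j.castSucc \ I j.succ).card = 0 := by omega
      have h0 : I j.castSucc ⊆ I j.succ := Finset.sdiff_eq_empty_iff_subset.1 (Finset.card_eq_zero.1 this)
      have := @h0 k
      tauto

theorem stmt14 (n : ℕ) (hn : 1 ≤ n) (S : Fin n → Finset ℕ) (hS : S ∈ Scal n) :
    (∃! I, I ∈ Ical n ∧ ItoS n I = S) ∧
    (∀ I ∈ Ical n, ItoS n I = S → ∀ i : Fin (n + 1),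
      I i =
        ((Finset.Icc 1 (i : ℕ)).biUnion (fun j => SvalAt n S j)) \
          ((Finset.Icc 1 (i : ℕ)).filter (fun j =>
            (Sinv n S j).min < ((i : ℕ) : WithTop ℕ) ∧
              (((i : ℕ) : WithBot ℕ) < (Sinv n S j).max)))) := by
  refine ⟨⟨fun i => FF n S i, FF_mem hS, ?_⟩, fun I hI e i => uniq hS I hI e i⟩
  rintro I ⟨hI, e⟩
  exact funext fun i => uniq hS I hI e i
end

section
/- For every n ≥ 2, the map (S_1, …, S_n) ↦ (S_1, …, S_{n−1}) is a bijection from 𝓢'_{n,n} onto 𝓢_{n−1}; in particular #𝓢'_{n,n} = #𝓢_{n−1}. -/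
theorem SvalAt_castSucc (m : ℕ) (S : Fin (m+1) → Finset ℕ) (j : ℕ) (hj : j ≤ m) :
    SvalAt m (fun k : Fin m => S k.castSucc) j = SvalAt (m+1) S j := by
  unfold SvalAt
  by_cases h : 1 ≤ j
  · rw [dif_pos ⟨h, hj⟩, dif_pos ⟨h, by omega⟩]
    rfl
  · rw [dif_neg (by omega), dif_neg (by omega)]

theorem SvalAt_last (m : ℕ) (S : Fin (m+1) → Finset ℕ) :
    SvalAt (m+1) S (m+1) = S (Fin.last m) := by
  unfold SvalAt
  rw [dif_pos ⟨by omega, le_rfl⟩]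
  rfl

theorem Sinv_castSucc (m : ℕ) (S : Fin (m+1) → Finset ℕ) (hS : S (Fin.last m) = {m+1})
    (i : ℕ) (hi : i ≤ m) :
    Sinv m (fun k : Fin m => S k.castSucc) i = Sinv (m+1) S i := by
  ext j
  simp only [Sinv, Finset.mem_filter, Finset.mem_Icc]
  constructor
  · rintro ⟨⟨h1, h2⟩, h3⟩
    rw [SvalAt_castSucc m S j h2] at h3
    exact ⟨⟨h1, by omega⟩, h3⟩
  · rintro ⟨⟨h1, h2⟩, h3⟩
    by_cases hj : j = m + 1
    · subst hj
      rw [SvalAt_last, hS, Finset.mem_singleton] at h3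
      omega
    · have hj' : j ≤ m := by omega
      rw [SvalAt_castSucc m S j hj']
      exact ⟨⟨h1, hj'⟩, h3⟩

theorem last_of_mem (m : ℕ) (S : Fin (m+1) → Finset ℕ) (h : S ∈ ScalLast (m+1) (m+1)) :
    S (Fin.last m) = {m+1} ∧ ∀ k : Fin m, S k.castSucc ⊆ Finset.Icc 1 m := by
  obtain ⟨⟨hsub, hall⟩, hinv⟩ := h
  constructor
  · obtain ⟨h1, -, h3⟩ := hall (m+1) (by omega) le_rfl
    have hmem : m + 1 ∈ Sinv (m+1) S (m+1) := by rw [hinv]; simp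
    have hmem2 := (Finset.mem_filter.1 hmem).2
    rw [SvalAt_last] at *
    rcases h1 with h1 | h1
    · obtain ⟨a, ha⟩ := Finset.card_eq_one.1 h1
      rw [ha, Finset.mem_singleton] at hmem2
      rw [ha, hmem2]
    · obtain ⟨i₁, i₂, h4, h5, h6⟩ := h3 h1
      have : i₁ ∈ Sinv (m+1) S (m+1) := by rw [h6]; simp
      rw [hinv, Finset.mem_singleton] at this
      omega
  · intro k x hx
    have hx1 := Finset.mem_Icc.1 (hsub _ hx)
    rw [Finset.mem_Icc]
    refine ⟨hx1.1, ?_⟩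
    by_contra hlt
    have hxe : x = m + 1 := by omega
    subst hxe
    have : (k : ℕ) + 1 ∈ Sinv (m+1) S (m+1) := by
      simp only [Sinv, Finset.mem_filter, Finset.mem_Icc]
      refine ⟨⟨by omega, by omega⟩, ?_⟩
      unfold SvalAt
      rw [dif_pos ⟨by omega, by omega⟩]
      exact hx
    rw [hinv, Finset.mem_singleton] at this
    omega

theorem mem_iff_aux (m : ℕ) (S : Fin (m+1) → Finset ℕ) (hS : S (Fin.last m) = {m+1})
    (hk : ∀ k : Fin m, S k.castSucc ⊆ Finset.Icc 1 m) :
    S ∈ ScalLast (m+1) (m+1) ↔ (fun k : Fin m => S k.castSucc) ∈ Scal m := by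
  constructor
  · rintro ⟨⟨hsub, hall⟩, hinv⟩
    refine ⟨hk, fun i h1 h2 => ?_⟩
    rw [SvalAt_castSucc m S i h2, Sinv_castSucc m S hS i h2]
    exact hall i h1 (by omega)
  · rintro ⟨-, hall⟩
    have hinv : Sinv (m+1) S (m+1) = {m+1} := by
      ext j
      simp only [Sinv, Finset.mem_filter, Finset.mem_Icc, Finset.mem_singleton]
      constructor
      · rintro ⟨⟨h1, h2⟩, h3⟩
        by_contra hne
        unfold SvalAt at h3
        rw [dif_pos ⟨h1, h2⟩] at h3
        have := Finset.mem_Icc.1 (hk ⟨j - 1, by omega⟩ h3)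
        omega
      · rintro rfl
        rw [SvalAt_last, hS]
        simp
    refine ⟨⟨?_, ?_⟩, hinv⟩
    · intro j
      refine Fin.lastCases ?_ (fun k => ?_) j
      · rw [hS]; simp
      · exact (hk k).trans (Finset.Icc_subset_Icc_right (by omega))
    · intro i h1 h2
      by_cases hi : i = m + 1
      · subst hi
        rw [hinv, SvalAt_last, hS]
        simp
      · have hi' : i ≤ m := by omega
        rw [← SvalAt_castSucc m S i hi', ← Sinv_castSucc m S hS i hi']
        exact hall i h1 hi'

theorem bij_aux (m : ℕ) :
    Set.BijOn (fun (S : Fin (m+1) → Finset ℕ) (k : Fin m) => S k.castSucc)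
      (ScalLast (m+1) (m+1)) (Scal m) := by
  refine ⟨?_, ?_, ?_⟩
  · intro S h
    obtain ⟨h1, h2⟩ := last_of_mem m S h
    exact (mem_iff_aux m S h1 h2).1 h
  · intro S h S' h' heq
    funext j
    refine Fin.lastCases ?_ (fun k => ?_) j
    · rw [(last_of_mem m S h).1, (last_of_mem m S' h').1]
    · exact congrFun heq k
  · intro T hT
    have e : (fun k : Fin m =>
        (Fin.snoc T {m+1} : Fin (m+1) → Finset ℕ) k.castSucc) = T := by
      funext k; simp
    refine ⟨(Fin.snoc T {m+1} : Fin (m+1) → Finset ℕ), ?_, e⟩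
    refine (mem_iff_aux m _ (by simp) ?_).2 (by rw [e]; exact hT)
    intro k
    simpa using hT.1 k

theorem stmt15 (n : ℕ) (hn : 2 ≤ n) :
    Set.BijOn (fun (S : Fin n → Finset ℕ) (j : Fin (n - 1)) => S (Fin.castLE (by omega) j))
      (ScalLast n n) (Scal (n - 1)) ∧
    (ScalLast n n).ncard = (Scal (n - 1)).ncard := by
  obtain ⟨m, rfl⟩ : ∃ m, n = m + 1 := ⟨n - 1, by omega⟩
  have hb := bij_aux m
  exact ⟨hb, hb.image_eq ▸ (Set.ncard_image_of_injOn hb.injOn).symm⟩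
end

section
/- For every n ≥ 1, the map (S_1, …, S_n) ↦ (S_1^t, …, S_n^t), where S_i^t is obtained from S_i by replacing every occurrence of 1 by n and every occurrence of n by 1, is an involution of 𝓢_n, and for all k, l ∈ [n] it restricts to a bijection from 𝓢_{n,k} ∩ 𝓢'_{n,l} onto 𝓢_{n,l} ∩ 𝓢'_{n,k}. -/
/-- The map `(S_1,…,S_n) ↦ (S_1^t,…,S_n^t)` : in every entry, each occurrence
of `1` is replaced by `n` and each occurrence of `n` by `1`. -/
def tS (n : ℕ) (S : Fin n → Finset ℕ) : Fin n → Finset ℕ :=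
  fun i => (S i).image (fun x => if x = 1 then n else if x = n then 1 else x)

def sw (n x : ℕ) : ℕ := if x = 1 then n else if x = n then 1 else x

theorem sw_sw (n x : ℕ) : sw n (sw n x) = x := by
  unfold sw; split_ifs <;> omega

theorem sw_inj (n : ℕ) : Function.Injective (sw n) :=
  (show Function.Involutive (sw n) from sw_sw n).injective

theorem sw_mem (n x : ℕ) (h1 : 1 ≤ x) (h2 : x ≤ n) : 1 ≤ sw n x ∧ sw n x ≤ n := by
  unfold sw; split_ifs <;> omega

theorem tS_apply (n : ℕ) (S : Fin n → Finset ℕ) (i : Fin n) :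
    tS n S i = (S i).image (sw n) := rfl

theorem SvalAt_tS (n : ℕ) (S : Fin n → Finset ℕ) (j : ℕ) :
    SvalAt n (tS n S) j = (SvalAt n S j).image (sw n) := by
  unfold SvalAt
  split_ifs
  · rfl
  · rfl

theorem mem_image_sw (n : ℕ) (A : Finset ℕ) (i : ℕ) : i ∈ A.image (sw n) ↔ sw n i ∈ A := by
  rw [Finset.mem_image]
  constructor
  · rintro ⟨a, ha, rfl⟩
    rwa [sw_sw]
  · intro h
    exact ⟨_, h, sw_sw n i⟩

theorem Sinv_tS (n : ℕ) (S : Fin n → Finset ℕ) (i : ℕ) :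
    Sinv n (tS n S) i = Sinv n S (sw n i) := by
  unfold Sinv
  ext j
  rw [Finset.mem_filter, Finset.mem_filter, SvalAt_tS, mem_image_sw]

theorem tS_tS (n : ℕ) (S : Fin n → Finset ℕ) : tS n (tS n S) = S := by
  funext i
  ext x
  rw [tS_apply, mem_image_sw, tS_apply, mem_image_sw, sw_sw]

theorem tS_mem (n : ℕ) (S : Fin n → Finset ℕ) (hS : S ∈ Scal n) : tS n S ∈ Scal n := by
  obtain ⟨h1, h2⟩ := hS
  refine ⟨?_, ?_⟩
  · intro j x hx
    rw [tS_apply, mem_image_sw] at hx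
    have h := Finset.mem_Icc.1 (h1 j hx)
    have := sw_mem n _ h.1 h.2
    rw [sw_sw] at this
    exact Finset.mem_Icc.2 this
  · intro i hi hin
    have hs := sw_mem n i hi hin
    rw [Sinv_tS, SvalAt_tS, Finset.card_image_of_injective _ (sw_inj n)]
    refine ⟨(h2 i hi hin).1, (h2 _ hs.1 hs.2).2.1, fun hc => ?_⟩
    obtain ⟨a, b, ha, hb, he⟩ := (h2 i hi hin).2.2 hc
    have hA : a ∈ Sinv n S i := by rw [he]; simp
    have hB : b ∈ Sinv n S i := by rw [he]; simp
    have hA := Finset.mem_Icc.1 (Finset.mem_filter.1 hA).1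
    have hB := Finset.mem_Icc.1 (Finset.mem_filter.1 hB).1
    have : sw n i = i := by unfold sw; split_ifs <;> omega
    rw [this]
    exact ⟨a, b, ha, hb, he⟩

theorem tS_maps (n k l : ℕ) (S : Fin n → Finset ℕ) (hS : S ∈ ScalFirst n k ∩ ScalLast n l) :
    tS n S ∈ ScalFirst n l ∩ ScalLast n k := by
  obtain ⟨⟨h, h1⟩, ⟨_, h2⟩⟩ := hS
  have e1 : sw n 1 = n := by simp [sw]
  have e2 : sw n n = 1 := by unfold sw; split_ifs <;> omega
  refine ⟨⟨tS_mem n S h, ?_⟩, ⟨tS_mem n S h, ?_⟩⟩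
  · rw [Sinv_tS, e1, h2]
  · rw [Sinv_tS, e2, h1]

theorem stmt16 (n : ℕ) (hn : 1 ≤ n) :
    (∀ S ∈ Scal n, tS n S ∈ Scal n ∧ tS n (tS n S) = S) ∧
    (∀ k l, 1 ≤ k → k ≤ n → 1 ≤ l → l ≤ n →
      Set.BijOn (tS n) (ScalFirst n k ∩ ScalLast n l)
        (ScalFirst n l ∩ ScalLast n k)) := by
  refine ⟨fun S hS => ⟨tS_mem n S hS, tS_tS n S⟩, fun k l _ _ _ _ => ⟨?_, ?_, ?_⟩⟩
  · exact fun S hS => tS_maps n k l S hS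
  · intro S _ T _ h
    rw [← tS_tS n S, h, tS_tS]
  · exact fun S hS => ⟨tS n S, tS_maps n l k S hS, tS_tS n S⟩
end

section
/- For every n ≥ 1, the map (S_1, …, S_n) ↦ (S_1^r, …, S_n^r) defined by S_i^r = {n+1−j : j ∈ S_{n+1−i}} is an involution of 𝓢_n, and for all k, l ∈ [n] it restricts to a bijection from 𝓢_{n,k} ∩ 𝓢'_{n,l} onto 𝓢_{n,n+1−l} ∩ 𝓢'_{n,n−k+1}. -/
/-- The map `(S_1,…,S_n) ↦ (S_1^r,…,S_n^r)` defined by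
`S_i^r = {n+1-j : j ∈ S_{n+1-i}}`. -/
def rS (n : ℕ) (S : Fin n → Finset ℕ) : Fin n → Finset ℕ :=
  fun i => (S i.rev).image (fun j => n + 1 - j)

theorem card_refl (n : ℕ) (A : Finset ℕ) (hA : A ⊆ Finset.Icc 1 n) :
    (A.image (fun j => n + 1 - j)).card = A.card := by
  apply Finset.card_image_of_injOn
  intro a ha b hb hab
  have h1 := Finset.mem_Icc.mp (hA ha)
  have h2 := Finset.mem_Icc.mp (hA hb)
  simp only at hab
  omega

theorem refl_refl (n : ℕ) (A : Finset ℕ) (hA : A ⊆ Finset.Icc 1 n) :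
    (A.image (fun j => n + 1 - j)).image (fun j => n + 1 - j) = A := by
  rw [Finset.image_image]
  conv_rhs => rw [← Finset.image_id (s := A)]
  apply Finset.image_congr
  intro a ha
  have h1 := Finset.mem_Icc.mp (hA ha)
  simp only [Function.comp, id]
  omega

theorem SvalAt_rS (n : ℕ) (S : Fin n → Finset ℕ) (i : ℕ) (h1 : 1 ≤ i) (h2 : i ≤ n) :
    SvalAt n (rS n S) i = (SvalAt n S (n + 1 - i)).image (fun j => n + 1 - j) := by
  have h3 : 1 ≤ n + 1 - i ∧ n + 1 - i ≤ n := by omega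
  simp only [SvalAt, rS, dif_pos h3, dif_pos (And.intro h1 h2)]
  congr 2
  apply Fin.ext
  simp only [Fin.val_rev]
  omega

theorem SvalAt_sub (n : ℕ) (S : Fin n → Finset ℕ) (hS : ∀ j : Fin n, S j ⊆ Finset.Icc 1 n)
    (i : ℕ) : SvalAt n S i ⊆ Finset.Icc 1 n := by
  unfold SvalAt
  split_ifs
  · exact hS _
  · simp

theorem Sinv_sub (n : ℕ) (S : Fin n → Finset ℕ) (i : ℕ) : Sinv n S i ⊆ Finset.Icc 1 n :=
  Finset.filter_subset _ _

theorem Sinv_rS (n : ℕ) (S : Fin n → Finset ℕ) (hS : ∀ j : Fin n, S j ⊆ Finset.Icc 1 n)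
    (i : ℕ) (h1 : 1 ≤ i) (h2 : i ≤ n) :
    Sinv n (rS n S) i = (Sinv n S (n + 1 - i)).image (fun j => n + 1 - j) := by
  ext j
  simp only [Sinv, Finset.mem_filter, Finset.mem_image, Finset.mem_Icc]
  constructor
  · rintro ⟨⟨hj1, hj2⟩, hm⟩
    rw [SvalAt_rS n S j hj1 hj2, Finset.mem_image] at hm
    obtain ⟨a, ha, hai⟩ := hm
    have := Finset.mem_Icc.mp (SvalAt_sub n S hS _ ha)
    obtain rfl : a = n + 1 - i := by omega
    exact ⟨n + 1 - j, ⟨by omega, ha⟩, by omega⟩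
  · rintro ⟨a, ⟨ha, hm⟩, rfl⟩
    refine ⟨by omega, ?_⟩
    rw [SvalAt_rS n S _ (by omega) (by omega), Finset.mem_image]
    refine ⟨n + 1 - i, ?_, by omega⟩
    rwa [show n + 1 - (n + 1 - a) = a by omega]

theorem rS_mem (n : ℕ) (S : Fin n → Finset ℕ) (hS : S ∈ Scal n) : rS n S ∈ Scal n := by
  obtain ⟨hs, h⟩ := hS
  refine ⟨?_, ?_⟩
  · intro j x hx
    simp only [rS, Finset.mem_image] at hx
    obtain ⟨a, ha, rfl⟩ := hx
    have := Finset.mem_Icc.mp (hs _ ha)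
    rw [Finset.mem_Icc]
    omega
  · intro i h1 h2
    obtain ⟨ha, hb, hc⟩ := h (n + 1 - i) (by omega) (by omega)
    rw [SvalAt_rS n S i h1 h2, Sinv_rS n S hs i h1 h2, card_refl _ _ (SvalAt_sub n S hs _),
      card_refl _ _ (Sinv_sub n S _)]
    refine ⟨ha, hb, fun h2c => ?_⟩
    obtain ⟨a, b, hai, hib, he⟩ := hc h2c
    have hsub := Sinv_sub n S (n + 1 - i)
    rw [he] at hsub
    have hA := Finset.mem_Icc.mp (hsub (show a ∈ ({a, b} : Finset ℕ) by simp))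
    have hB := Finset.mem_Icc.mp (hsub (show b ∈ ({a, b} : Finset ℕ) by simp))
    refine ⟨n + 1 - b, n + 1 - a, by omega, by omega, ?_⟩
    rw [he, Finset.image_insert, Finset.image_singleton, Finset.pair_comm]

theorem rS_rS (n : ℕ) (S : Fin n → Finset ℕ) (hS : S ∈ Scal n) : rS n (rS n S) = S := by
  funext i
  simp only [rS, Fin.rev_rev]
  exact refl_refl n _ (hS.1 i)

theorem rS_maps (n : ℕ) (hn : 1 ≤ n) (k l : ℕ) (S : Fin n → Finset ℕ)
    (hS : S ∈ ScalFirst n k ∩ ScalLast n l) :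
    rS n S ∈ ScalFirst n (n + 1 - l) ∩ ScalLast n (n + 1 - k) := by
  obtain ⟨⟨h, h1⟩, ⟨_, h2⟩⟩ := hS
  refine ⟨⟨rS_mem n S h, ?_⟩, ⟨rS_mem n S h, ?_⟩⟩
  · rw [Sinv_rS n S h.1 1 le_rfl hn, show n + 1 - 1 = n by omega, h2, Finset.image_singleton]
  · rw [Sinv_rS n S h.1 n hn le_rfl, show n + 1 - n = 1 by omega, h1, Finset.image_singleton]

theorem stmt17 (n : ℕ) (hn : 1 ≤ n) :
    (∀ S ∈ Scal n, rS n S ∈ Scal n ∧ rS n (rS n S) = S) ∧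
    (∀ k l, 1 ≤ k → k ≤ n → 1 ≤ l → l ≤ n →
      Set.BijOn (rS n) (ScalFirst n k ∩ ScalLast n l)
        (ScalFirst n (n + 1 - l) ∩ ScalLast n (n - k + 1))) := by
  refine ⟨fun S hS => ⟨rS_mem n S hS, rS_rS n S hS⟩, ?_⟩
  intro k l hk1 hk2 hl1 hl2
  rw [show n - k + 1 = n + 1 - k by omega]
  refine ⟨fun S hS => rS_maps n hn k l S hS, ?_, ?_⟩
  · intro S hS T hT hST
    rw [← rS_rS n S hS.1.1, ← rS_rS n T hT.1.1, hST]
  · intro T hT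
    refine ⟨rS n T, ?_, rS_rS n T hT.1.1⟩
    have := rS_maps n hn _ _ T hT
    rwa [show n + 1 - (n + 1 - k) = k by omega, show n + 1 - (n + 1 - l) = l by omega] at this
end
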